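/- Suppose 1 < p < ∞, n + 1/p < α < n + 1, and μ is a positive Borel measure on 𝒰 satisfying ∫_𝒰 |wₙ + i|^{−α₀} dμ(w) < ∞ for some α₀ > 0 and which is a Carleson measure for A¹(𝒰). Then for every f ∈ 𝒮_α, the function T_μ f(z) = ∫_𝒰 K(z,w) f(w) dμ(w) is holomorphic on 𝒰 and belongs to Aᵖ(𝒰), i.e. ∫_𝒰 |T_μ f|ᵖ dV < ∞. -/

import Mathlib

open MeasureTheory Filter

noncomputable section

/-- Points of ℂⁿ written `z = (z′, zₙ)` with `z′ ∈ ℂ^m`, `m = n - 1`. -/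
abbrev SPoint (m : ℕ) := (Fin m → ℂ) × ℂ

/-- `ρ(z,w) = (i/2)(w̄ₙ − zₙ) − z′·w̄′`. -/
def srho2 {m : ℕ} (z w : SPoint m) : ℂ :=
  Complex.I / 2 * ((starRingEnd ℂ) w.2 - z.2) - ∑ j, z.1 j * (starRingEnd ℂ) (w.1 j)

/-- `ρ(z) = Im zₙ − |z′|²`. -/
def srho {m : ℕ} (z : SPoint m) : ℝ :=
  z.2.im - ∑ j, ‖z.1 j‖ ^ 2

/-- The Siegel upper half-space `𝒰 = {z : ρ(z) > 0}`. -/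
def Siegel (m : ℕ) : Set (SPoint m) := {z | 0 < srho z}

/-- The Bergman kernel `K(z,w) = (n!/(4πⁿ)) ρ(z,w)^{−(n+1)}` (points in ℂⁿ = ℂ^{n-1} × ℂ). -/
def sK (n : ℕ) (z w : SPoint (n - 1)) : ℂ :=
  (n.factorial : ℂ) / (4 * (Real.pi : ℂ) ^ n) * srho2 z w ^ (-(n + 1 : ℤ))

/-- Inverse hyperbolic tangent. -/
def artanh (x : ℝ) : ℝ := (1 / 2) * Real.log ((1 + x) / (1 - x))

/-- The Bergman distance `β(z,w) = artanh √(1 − ρ(z)ρ(w)/|ρ(z,w)|²)`. -/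
def sbeta {m : ℕ} (z w : SPoint m) : ℝ :=
  artanh (Real.sqrt (1 - srho z * srho w / ‖srho2 z w‖ ^ 2))

/-- The Bergman metric ball `D(z,r)`. -/
def sball {m : ℕ} (z : SPoint m) (r : ℝ) : Set (SPoint m) :=
  {w ∈ Siegel m | sbeta z w < r}

/-- Membership in the Bergman space `Aᵖ(𝒰)`: holomorphic with `∫_𝒰 |f|ᵖ dV < ∞`. -/
def MemAp (n : ℕ) (p : ℝ) (f : SPoint (n - 1) → ℂ) : Prop :=
  DifferentiableOn ℂ f (Siegel (n - 1)) ∧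
    IntegrableOn (fun z => ‖f z‖ ^ p) (Siegel (n - 1)) volume

/-- `‖f‖ₚ = (∫_𝒰 |f|ᵖ dV)^{1/p}`. -/
def bNorm (n : ℕ) (p : ℝ) (f : SPoint (n - 1) → ℂ) : ℝ :=
  (∫ z in Siegel (n - 1), ‖f z‖ ^ p) ^ (1 / p)

/-- The space `𝒮_α` of holomorphic `f` on `𝒰` with `sup_z |zₙ + i|^α |f(z)| < ∞`. -/
def SAlpha (n : ℕ) (α : ℝ) (f : SPoint (n - 1) → ℂ) : Prop :=
  DifferentiableOn ℂ f (Siegel (n - 1)) ∧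
    ∃ M : ℝ, ∀ z ∈ Siegel (n - 1), ‖z.2 + Complex.I‖ ^ α * ‖f z‖ ≤ M

end

open scoped ENNReal

section RadialIntegrals

lemma lintegral_add_norm_rpow_le (E : Type*) [NormedAddCommGroup E] [NormedSpace ℝ E]
    [FiniteDimensional ℝ E] [MeasurableSpace E] [BorelSpace E] (μ : Measure E)
    [μ.IsAddHaarMeasure] {s : ℝ} (hs : (Module.finrank ℝ E : ℝ) < s) :
    ∃ C : ℝ, 0 ≤ C ∧ ∀ A : ℝ, 0 < A →
      ∫⁻ x, ENNReal.ofReal ((A + ‖x‖) ^ (-s)) ∂μ ≤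
        ENNReal.ofReal (C * A ^ ((Module.finrank ℝ E : ℝ) - s)) := by
  refine ⟨∫ x, (1 + ‖x‖) ^ (-s) ∂μ, integral_nonneg fun x => by positivity, fun A hA => ?_⟩
  have hscale : ∀ x : E, (A + ‖x‖) ^ (-s) = A ^ (-s) * (1 + ‖A⁻¹ • x‖) ^ (-s) := by
    intro x
    rw [norm_smul, Real.norm_of_nonneg (by positivity),
      ← Real.mul_rpow hA.le (by positivity)]
    congr 1
    field_simp
  have hint : Integrable (fun x : E => A ^ (-s) * (1 + ‖A⁻¹ • x‖) ^ (-s)) μ :=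
    ((integrable_one_add_norm (μ := μ) hs).comp_smul (inv_ne_zero hA.ne')).const_mul _
  simp_rw [hscale]
  rw [← ofReal_integral_eq_lintegral_ofReal hint (ae_of_all _ fun x => by positivity),
    integral_const_mul,
    Measure.integral_comp_inv_smul_of_nonneg μ (fun x : E => (1 + ‖x‖) ^ (-s)) hA.le]
  apply le_of_eq
  rw [smul_eq_mul, sub_eq_add_neg, Real.rpow_add hA, Real.rpow_natCast]
  congr 1
  ring

lemma lintegral_add_norm_sq_rpow_le (E : Type*) [NormedAddCommGroup E] [NormedSpace ℝ E]
    [FiniteDimensional ℝ E] [MeasurableSpace E] [BorelSpace E] (μ : Measure E)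
    [μ.IsAddHaarMeasure] {s : ℝ} (hs : (Module.finrank ℝ E : ℝ) < 2 * s) :
    ∃ C : ℝ, 0 ≤ C ∧ ∀ A : ℝ, 0 < A →
      ∫⁻ x, ENNReal.ofReal ((A + ‖x‖ ^ 2) ^ (-s)) ∂μ ≤
        ENNReal.ofReal (C * A ^ ((Module.finrank ℝ E : ℝ) / 2 - s)) := by
  obtain ⟨C, hC, h⟩ := lintegral_add_norm_rpow_le E μ hs
  refine ⟨2 ^ s * C, by positivity, fun A hA => ?_⟩
  have hle : ∀ x : E, (A + ‖x‖ ^ 2) ^ (-s) ≤ 2 ^ s * (√A + ‖x‖) ^ (-(2 * s)) := by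
    intro x
    have h1 : (√A + ‖x‖) ^ 2 / 2 ≤ A + ‖x‖ ^ 2 := by
      nlinarith [Real.sq_sqrt hA.le, sq_nonneg (√A - ‖x‖)]
    have hpos : 0 < √A + ‖x‖ := by positivity
    calc (A + ‖x‖ ^ 2) ^ (-s) ≤ ((√A + ‖x‖) ^ 2 / 2) ^ (-s) :=
          Real.rpow_le_rpow_of_nonpos (by positivity) h1 (by linarith)
      _ = 2 ^ s * (√A + ‖x‖) ^ (-(2 * s)) := by
          rw [Real.div_rpow (by positivity) (by positivity), ← Real.rpow_natCast,
            ← Real.rpow_mul hpos.le, Real.rpow_neg (by positivity : (0 : ℝ) ≤ 2)]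
          push_cast
          rw [div_inv_eq_mul, mul_comm]
          congr 2
          ring
  calc ∫⁻ x, ENNReal.ofReal ((A + ‖x‖ ^ 2) ^ (-s)) ∂μ
      ≤ ∫⁻ x, ENNReal.ofReal (2 ^ s) * ENNReal.ofReal ((√A + ‖x‖) ^ (-(2 * s))) ∂μ :=
        lintegral_mono fun x => by
          rw [← ENNReal.ofReal_mul (by positivity)]
          exact ENNReal.ofReal_le_ofReal (hle x)
    _ ≤ ENNReal.ofReal (2 ^ s) *
        ENNReal.ofReal (C * √A ^ ((Module.finrank ℝ E : ℝ) - 2 * s)) := by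
        rw [lintegral_const_mul' _ _ ENNReal.ofReal_ne_top]
        gcongr
        exact h _ (Real.sqrt_pos.2 hA)
    _ = _ := by
        rw [← ENNReal.ofReal_mul (by positivity), Real.sqrt_eq_rpow, ← Real.rpow_mul hA.le,
          mul_assoc]
        congr 4
        ring

lemma lintegral_rpow_mul_add_rpow_le {a s : ℝ} (ha : a < 1) (hs : 0 ≤ s)
    (hsa : 1 < a + s) :
    ∃ C : ℝ, 0 ≤ C ∧ ∀ A : ℝ, 0 < A →
      ∫⁻ t in Set.Ioi (0 : ℝ), ENNReal.ofReal (t ^ (-a) * (t + A) ^ (-s)) ≤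
        ENNReal.ofReal (C * A ^ (1 - a - s)) := by
  refine ⟨1 / (1 - a) + 1 / (a + s - 1),
    add_nonneg (one_div_nonneg.2 (by linarith)) (one_div_nonneg.2 (by linarith)), fun A hA => ?_⟩
  have hnear : ∫⁻ t in Set.Ioc 0 A, ENNReal.ofReal (t ^ (-a) * (t + A) ^ (-s)) ≤
      ENNReal.ofReal (1 / (1 - a) * A ^ (1 - a - s)) := by
    calc _ ≤ ∫⁻ t in Set.Ioc 0 A, ENNReal.ofReal (t ^ (-a) * A ^ (-s)) := by
          refine setLIntegral_mono' measurableSet_Ioc fun t ht => ENNReal.ofReal_le_ofReal ?_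
          refine mul_le_mul_of_nonneg_left ?_ (Real.rpow_nonneg ht.1.le _)
          exact Real.rpow_le_rpow_of_nonpos hA (by linarith [ht.1]) (by linarith)
      _ = ENNReal.ofReal (∫ t in Set.Ioc 0 A, t ^ (-a) * A ^ (-s)) := by
          refine (ofReal_integral_eq_lintegral_ofReal ?_ ?_).symm
          · refine Integrable.mul_const ?_ _
            exact (intervalIntegrable_iff_integrableOn_Ioc_of_le hA.le).1
              (intervalIntegral.intervalIntegrable_rpow' (by linarith))
          · refine (ae_restrict_iff' measurableSet_Ioc).2 (ae_of_all _ fun t ht => ?_)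
            have := ht.1
            simp only [Pi.zero_apply]
            positivity
      _ = _ := by
          rw [integral_mul_const, ← intervalIntegral.integral_of_le hA.le,
            integral_rpow (Or.inl (by linarith)), Real.zero_rpow (by linarith),
            neg_add_eq_sub, sub_eq_add_neg (1 - a) s, Real.rpow_add hA (1 - a)]
          congr 1
          ring
  have hfar : ∫⁻ t in Set.Ioi A, ENNReal.ofReal (t ^ (-a) * (t + A) ^ (-s)) ≤
      ENNReal.ofReal (1 / (a + s - 1) * A ^ (1 - a - s)) := by
    calc _ ≤ ∫⁻ t in Set.Ioi A, ENNReal.ofReal (t ^ (-a - s)) := by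
          refine setLIntegral_mono' measurableSet_Ioi fun t ht => ENNReal.ofReal_le_ofReal ?_
          have ht0 : 0 < t := hA.trans ht
          rw [sub_eq_add_neg, Real.rpow_add ht0]
          refine mul_le_mul_of_nonneg_left ?_ (Real.rpow_nonneg ht0.le _)
          exact Real.rpow_le_rpow_of_nonpos ht0 (by linarith) (by linarith)
      _ = ENNReal.ofReal (∫ t in Set.Ioi A, t ^ (-a - s)) := by
          refine (ofReal_integral_eq_lintegral_ofReal
            (integrableOn_Ioi_rpow_of_lt (by linarith) hA) ?_).symm
          refine (ae_restrict_iff' measurableSet_Ioi).2 (ae_of_all _ fun t ht => ?_)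
          exact Real.rpow_nonneg (hA.trans ht).le _
      _ = _ := by
          rw [integral_Ioi_rpow_of_lt (by linarith) hA, show 1 - a - s = -a - s + 1 by ring]
          congr 1
          rw [show a + s - 1 = -(-a - s + 1) by ring, neg_div, one_div, inv_neg]
          ring
  have h1 : 0 < 1 - a := by linarith
  have h2 : 0 < a + s - 1 := by linarith
  rw [← Set.Ioc_union_Ioi_eq_Ioi hA.le, add_mul, ENNReal.ofReal_add (by positivity)
    (by positivity)]
  exact (lintegral_union_le _ _ _).trans (add_le_add hnear hfar)

end RadialIntegrals

section SiegelGeometry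

variable {m : ℕ}

lemma continuous_srho : Continuous (srho : SPoint m → ℝ) := by
  unfold srho
  fun_prop

lemma continuous_srho2_right (z : SPoint m) : Continuous (fun w => srho2 z w) := by
  unfold srho2
  exact (continuous_const.mul ((Complex.continuous_conj.comp continuous_snd).sub
    continuous_const)).sub (continuous_finsetSum _ fun j _ => continuous_const.mul
      (Complex.continuous_conj.comp ((continuous_apply j).comp continuous_fst)))

lemma continuous_uncurry_srho2 :
    Continuous (fun x : SPoint m × SPoint m => srho2 x.1 x.2) := by
  unfold srho2
  refine (continuous_const.mul ((Complex.continuous_conj.comp ?_).sub ?_)).sub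
    (continuous_finsetSum _ fun j _ => Continuous.mul ?_ (Complex.continuous_conj.comp ?_)) <;>
  fun_prop

lemma isOpen_Siegel (m : ℕ) : IsOpen (Siegel m) :=
  isOpen_lt continuous_const continuous_srho

lemma conj_srho2 (z w : SPoint m) : (starRingEnd ℂ) (srho2 z w) = srho2 w z := by
  simp only [srho2, map_sub, map_mul, map_div₀, map_sum, Complex.conj_I, Complex.conj_conj,
    map_ofNat]
  congr 1
  · ring
  · exact Finset.sum_congr rfl fun j _ => mul_comm _ _

lemma norm_srho2_comm (z w : SPoint m) : ‖srho2 z w‖ = ‖srho2 w z‖ := by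
  rw [← conj_srho2 z w, RCLike.norm_conj]

lemma two_mul_re_srho2 (z w : SPoint m) :
    2 * (srho2 z w).re = srho z + srho w + ∑ j, ‖w.1 j - z.1 j‖ ^ 2 := by
  have hj : ∀ j, ‖w.1 j - z.1 j‖ ^ 2 =
      ‖z.1 j‖ ^ 2 + ‖w.1 j‖ ^ 2 - 2 * (z.1 j * (starRingEnd ℂ) (w.1 j)).re := by
    intro j
    simp only [Complex.sq_norm, Complex.normSq_apply, Complex.sub_re, Complex.sub_im,
      Complex.mul_re, Complex.conj_re, Complex.conj_im]
    ring
  simp only [hj, srho2, srho, Finset.sum_sub_distrib, Finset.sum_add_distrib, Complex.sub_re,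
    Complex.re_sum, ← Finset.mul_sum]
  have : (Complex.I / 2 * ((starRingEnd ℂ) w.2 - z.2)).re = (z.2.im + w.2.im) / 2 := by
    simp [Complex.mul_re]
    ring
  rw [this]
  ring

lemma norm_sq_le_sum_norm_sq (x : Fin m → ℂ) : ‖x‖ ^ 2 ≤ ∑ j, ‖x j‖ ^ 2 := by
  have : ‖x‖ ≤ √(∑ j, ‖x j‖ ^ 2) := by
    refine (pi_norm_le_iff_of_nonneg (Real.sqrt_nonneg _)).2 fun j => ?_
    refine Real.le_sqrt_of_sq_le ?_
    exact Finset.single_le_sum (f := fun j => ‖x j‖ ^ 2) (fun i _ => sq_nonneg _)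
      (Finset.mem_univ j)
  calc ‖x‖ ^ 2 ≤ √(∑ j, ‖x j‖ ^ 2) ^ 2 := by gcongr
    _ = _ := Real.sq_sqrt (Finset.sum_nonneg fun j _ => sq_nonneg _)

lemma srho_add_le_two_mul_norm_srho2 (z w : SPoint m) :
    srho z + srho w + ‖w.1 - z.1‖ ^ 2 ≤ 2 * ‖srho2 z w‖ := by
  have h1 := norm_sq_le_sum_norm_sq (w.1 - z.1)
  have h2 := two_mul_re_srho2 z w
  have h3 := Complex.re_le_norm (srho2 z w)
  simp only [Pi.sub_apply] at h1
  linarith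

lemma srho2_ne_zero {z w : SPoint m} (hz : z ∈ Siegel m) (hw : w ∈ Siegel m) :
    srho2 z w ≠ 0 := by
  have h := srho_add_le_two_mul_norm_srho2 z w
  have hz' : 0 < srho z := hz
  have hw' : 0 < srho w := hw
  intro h0
  rw [h0, norm_zero] at h
  nlinarith [sq_nonneg ‖w.1 - z.1‖]

lemma exists_sub_le_two_mul_norm_srho2 (z : SPoint m) (x : Fin m → ℂ) :
    ∃ b : ℝ, ∀ ζ : ℂ, |ζ.re - b| ≤ 2 * ‖srho2 z (x, ζ)‖ := by
  refine ⟨z.2.re + 2 * (∑ j, z.1 j * (starRingEnd ℂ) (x j)).im, fun ζ => ?_⟩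
  have h := Complex.abs_im_le_norm (srho2 z (x, ζ))
  have him : ζ.re - (z.2.re + 2 * (∑ j, z.1 j * (starRingEnd ℂ) (x j)).im) =
      2 * (srho2 z (x, ζ)).im := by
    have : (Complex.I / 2 * ((starRingEnd ℂ) ζ - z.2)).im = (ζ.re - z.2.re) / 2 := by
      simp [Complex.mul_im]
      ring
    simp only [srho2, Complex.sub_im, this]
    ring
  rw [him, abs_mul, abs_two]
  linarith

/-- The base point `(0, i)` of the Siegel upper half-space. -/
def siegelBase (m : ℕ) : SPoint m := (0, Complex.I)

lemma srho_siegelBase : srho (siegelBase m) = 1 := by simp [srho, siegelBase]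

lemma siegelBase_mem : siegelBase m ∈ Siegel m := by
  simp [Siegel, srho_siegelBase]

lemma norm_add_I_eq (w : SPoint m) : ‖w.2 + Complex.I‖ = 2 * ‖srho2 (siegelBase m) w‖ := by
  have : srho2 (siegelBase m) w = Complex.I / 2 * (starRingEnd ℂ) (w.2 + Complex.I) := by
    simp [srho2, siegelBase, sub_eq_add_neg]
  rw [this, norm_mul, RCLike.norm_conj]
  simp

lemma norm_add_I_pos {w : SPoint m} (hw : w ∈ Siegel m) : 0 < ‖w.2 + Complex.I‖ := by
  rw [norm_add_I_eq]
  have := norm_pos_iff.2 (srho2_ne_zero siegelBase_mem hw)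
  positivity

end SiegelGeometry

section ForelliRudin

variable {m : ℕ}

lemma lintegral_complex_eq (F : ℂ → ℝ≥0∞) (hF : Measurable F) :
    ∫⁻ ζ, F ζ = ∫⁻ y : ℝ, ∫⁻ x : ℝ, F ⟨x, y⟩ := by
  rw [← (Complex.volume_preserving_equiv_real_prod.symm).lintegral_comp_emb
    (MeasurableEquiv.measurableEmbedding _) F, Measure.volume_eq_prod, lintegral_prod_symm]
  · rfl
  · exact (hF.comp (MeasurableEquiv.measurable _)).aemeasurable

lemma measurable_norm_srho2_rpow (s : ℝ) :
    Measurable (fun x : SPoint m × SPoint m => ‖srho2 x.1 x.2‖ ^ s) :=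
  continuous_uncurry_srho2.measurable.norm.pow_const s

/-- Forelli–Rudin type estimate for the Siegel upper half-space. -/
lemma lintegral_norm_srho2_rpow_le {s a : ℝ} (hs : 1 < s) (ha : a < 1)
    (hsa : (m : ℝ) + 2 < s + a) :
    ∃ C : ℝ, 0 ≤ C ∧ ∀ z ∈ Siegel m,
      ∫⁻ w in Siegel m, ENNReal.ofReal (‖srho2 z w‖ ^ (-s) * srho w ^ (-a)) ≤
        ENNReal.ofReal (C * srho z ^ ((m : ℝ) + 2 - s - a)) := by
  have hm : (0 : ℝ) ≤ m := Nat.cast_nonneg m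
  obtain ⟨C₁, hC₁, h₁⟩ := lintegral_add_norm_rpow_le ℝ volume (s := s) (by simpa using hs)
  obtain ⟨C₂, hC₂, h₂⟩ := lintegral_rpow_mul_add_rpow_le (a := a) (s := s - 1) ha (by linarith)
    (by linarith)
  have hdim : (Module.finrank ℝ (Fin m → ℂ) : ℝ) = 2 * m := by
    rw [Module.finrank_pi_fintype]
    simp [Complex.finrank_real_complex, mul_comm]
  obtain ⟨C₃, hC₃, h₃⟩ := lintegral_add_norm_sq_rpow_le (Fin m → ℂ) volume (s := s + a - 2)
    (by rw [hdim]; linarith)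
  rw [hdim] at h₃
  simp only [Module.finrank_self, Nat.cast_one] at h₁
  refine ⟨4 ^ s * C₁ * C₂ * C₃, by positivity, fun z hz => ?_⟩
  have hz0 : 0 < srho z := hz
  have hmeas : Measurable (fun w : SPoint m =>
      ENNReal.ofReal (‖srho2 z w‖ ^ (-s) * srho w ^ (-a))) :=
    (((continuous_srho2_right z).measurable.norm.pow_const _).mul
      (continuous_srho.measurable.pow_const _)).ennreal_ofReal
  rw [← lintegral_indicator (isOpen_Siegel m).measurableSet]
  set F : SPoint m → ℝ≥0∞ := (Siegel m).indicator
    fun w => ENNReal.ofReal (‖srho2 z w‖ ^ (-s) * srho w ^ (-a))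
  have hFm : Measurable F := hmeas.indicator (isOpen_Siegel m).measurableSet
  have hre : ∀ (x : Fin m → ℂ) (y : ℝ), ∫⁻ u : ℝ, F (x, ⟨u, y⟩) ≤
      (Set.Ioi (0 : ℝ)).indicator (fun t => ENNReal.ofReal (4 ^ s * C₁) *
        ENNReal.ofReal (t ^ (-a) * (t + (srho z + ‖x - z.1‖ ^ 2)) ^ (-(s - 1))))
        (y - ∑ j, ‖x j‖ ^ 2) := by
    intro x y
    set t := y - ∑ j, ‖x j‖ ^ 2
    have hρ : ∀ u : ℝ, srho ((x, ⟨u, y⟩) : SPoint m) = t := fun u => rfl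
    by_cases ht0 : 0 < t
    · have hB : 0 < t + (srho z + ‖x - z.1‖ ^ 2) := by positivity
      obtain ⟨b, hb⟩ := exists_sub_le_two_mul_norm_srho2 z x
      rw [Set.indicator_of_mem (Set.mem_Ioi.2 ht0)]
      set B := t + (srho z + ‖x - z.1‖ ^ 2)
      have hpt : ∀ u : ℝ, F (x, ⟨u, y⟩) ≤
          ENNReal.ofReal (4 ^ s * t ^ (-a)) * ENNReal.ofReal ((B + ‖u - b‖) ^ (-s)) := by
        intro u
        refine (Set.indicator_le_self' (fun _ _ => zero_le) _).trans ?_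
        rw [← ENNReal.ofReal_mul (by positivity), hρ u]
        refine ENNReal.ofReal_le_ofReal ?_
        have h4 : (B + ‖u - b‖) / 4 ≤ ‖srho2 z (x, ⟨u, y⟩)‖ := by
          have e1 := srho_add_le_two_mul_norm_srho2 z (x, ⟨u, y⟩)
          have e2 := hb ⟨u, y⟩
          rw [hρ u] at e1
          rw [Real.norm_eq_abs]
          simp only at e1 e2
          linarith
        calc ‖srho2 z (x, ⟨u, y⟩)‖ ^ (-s) * t ^ (-a)
            ≤ ((B + ‖u - b‖) / 4) ^ (-s) * t ^ (-a) := by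
              refine mul_le_mul_of_nonneg_right ?_ (by positivity)
              exact Real.rpow_le_rpow_of_nonpos (by positivity) h4 (by linarith)
          _ = 4 ^ s * t ^ (-a) * (B + ‖u - b‖) ^ (-s) := by
              rw [Real.div_rpow (by positivity) (by positivity),
                Real.rpow_neg (by positivity : (0 : ℝ) ≤ 4), div_inv_eq_mul]
              ring
      calc ∫⁻ u : ℝ, F (x, ⟨u, y⟩)
          ≤ ∫⁻ u : ℝ, ENNReal.ofReal (4 ^ s * t ^ (-a)) *
              ENNReal.ofReal ((B + ‖u - b‖) ^ (-s)) := lintegral_mono hpt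
        _ = ENNReal.ofReal (4 ^ s * t ^ (-a)) *
              ∫⁻ u : ℝ, ENNReal.ofReal ((B + ‖u‖) ^ (-s)) := by
            rw [lintegral_const_mul' _ _ ENNReal.ofReal_ne_top,
              lintegral_sub_right_eq_self (fun u : ℝ => ENNReal.ofReal ((B + ‖u‖) ^ (-s))) b]
        _ ≤ ENNReal.ofReal (4 ^ s * t ^ (-a)) * ENNReal.ofReal (C₁ * B ^ (1 - s)) := by
            gcongr
            exact h₁ B hB
        _ = _ := by
            rw [← ENNReal.ofReal_mul (by positivity), ← ENNReal.ofReal_mul (by positivity),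
              neg_sub]
            congr 1
            ring
    · have : ∀ u : ℝ, F (x, ⟨u, y⟩) = 0 := by
        intro u
        refine Set.indicator_of_notMem (fun h => ht0 ?_) _
        rw [← hρ u]
        exact h
      simp [this]
  have hfib : ∀ x : Fin m → ℂ, ∫⁻ ζ : ℂ, F (x, ζ) ≤
      ENNReal.ofReal (4 ^ s * C₁ * C₂) *
        ENNReal.ofReal ((srho z + ‖x - z.1‖ ^ 2) ^ (-(s + a - 2))) := by
    intro x
    have hB : 0 < srho z + ‖x - z.1‖ ^ 2 := by positivity
    set B := srho z + ‖x - z.1‖ ^ 2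
    rw [lintegral_complex_eq (fun ζ => F (x, ζ)) (hFm.comp measurable_prodMk_left)]
    refine (lintegral_mono (hre x)).trans ?_
    rw [lintegral_sub_right_eq_self (fun y : ℝ => (Set.Ioi (0 : ℝ)).indicator
      (fun t => ENNReal.ofReal (4 ^ s * C₁) *
        ENNReal.ofReal (t ^ (-a) * (t + B) ^ (-(s - 1)))) y),
      lintegral_indicator measurableSet_Ioi, lintegral_const_mul' _ _ ENNReal.ofReal_ne_top]
    refine (mul_le_mul_right (h₂ B hB) _).trans (le_of_eq ?_)
    rw [← ENNReal.ofReal_mul (by positivity), ← ENNReal.ofReal_mul (by positivity),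
      show 1 - a - (s - 1) = -(s + a - 2) by ring]
    congr 1
    ring
  calc ∫⁻ w, F w ≤ ∫⁻ x : Fin m → ℂ, ∫⁻ ζ : ℂ, F (x, ζ) := lintegral_prod_le F
    _ ≤ ∫⁻ x : Fin m → ℂ, ENNReal.ofReal (4 ^ s * C₁ * C₂) *
        ENNReal.ofReal ((srho z + ‖x - z.1‖ ^ 2) ^ (-(s + a - 2))) := lintegral_mono hfib
    _ = ENNReal.ofReal (4 ^ s * C₁ * C₂) * ∫⁻ x : Fin m → ℂ,
        ENNReal.ofReal ((srho z + ‖x‖ ^ 2) ^ (-(s + a - 2))) := by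
        rw [lintegral_const_mul' _ _ ENNReal.ofReal_ne_top, lintegral_sub_right_eq_self
          (fun x : Fin m → ℂ => ENNReal.ofReal ((srho z + ‖x‖ ^ 2) ^ (-(s + a - 2)))) z.1]
    _ ≤ ENNReal.ofReal (4 ^ s * C₁ * C₂) * ENNReal.ofReal
        (C₃ * srho z ^ (2 * (m : ℝ) / 2 - (s + a - 2))) := by
        gcongr
        exact h₃ _ hz0
    _ = _ := by
        rw [← ENNReal.ofReal_mul (by positivity),
          show 2 * (m : ℝ) / 2 - (s + a - 2) = m + 2 - s - a by ring]
        congr 1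
        ring

end ForelliRudin

section Schur

/-- The Schur test for a positive kernel. -/
lemma lintegral_kernel_rpow_le {X : Type*} [MeasurableSpace X] {ν : Measure X} [SFinite ν]
    {k : X → X → ℝ≥0∞} (hk : Measurable (Function.uncurry k)) {h g : X → ℝ≥0∞}
    (hh : Measurable h) (hg : Measurable g) (hh0 : ∀ᵐ x ∂ν, h x ≠ 0 ∧ h x ≠ ⊤)
    {p q : ℝ} (hpq : p.HolderConjugate q) {A B : ℝ≥0∞}
    (hA : ∀ᵐ x ∂ν, ∫⁻ y, k x y * h y ^ q ∂ν ≤ A * h x ^ q)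
    (hB : ∀ᵐ y ∂ν, ∫⁻ x, k x y * h x ^ p ∂ν ≤ B * h y ^ p) :
    ∫⁻ x, (∫⁻ y, k x y * g y ∂ν) ^ p ∂ν ≤ A ^ (p / q) * B * ∫⁻ y, g y ^ p ∂ν := by
  have hp := hpq.pos
  have hq := hpq.symm.pos
  have hkx : ∀ x, Measurable (k x) := fun x => hk.comp measurable_prodMk_left
  have hky : ∀ y, Measurable (fun x => k x y) := fun y => hk.comp measurable_prodMk_right
  have hholder : ∀ᵐ x ∂ν, (∫⁻ y, k x y * g y ∂ν) ^ p ≤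
      A ^ (p / q) * ∫⁻ y, h x ^ p * (k x y * (h y)⁻¹ ^ p * g y ^ p) ∂ν := by
    filter_upwards [hA] with x hx
    have hsplit : ∫⁻ y, k x y * g y ∂ν =
        ∫⁻ y, ((fun y => k x y ^ (1 / q) * h y) *
          fun y => k x y ^ (1 / p) * (h y)⁻¹ * g y) y ∂ν := by
      refine lintegral_congr_ae ?_
      filter_upwards [hh0] with y hy
      have h1 : k x y ^ (1 / q) * k x y ^ (1 / p) = k x y := by
        rw [← ENNReal.rpow_add_of_nonneg _ _ (by positivity) (by positivity), add_comm,
          one_div, one_div, hpq.inv_add_inv_eq_one, ENNReal.rpow_one]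
      calc k x y * g y = (k x y ^ (1 / q) * k x y ^ (1 / p)) * (h y * (h y)⁻¹) * g y := by
            rw [h1, ENNReal.mul_inv_cancel hy.1 hy.2, mul_one]
        _ = _ := by simp only [Pi.mul_apply]; ring
    have hH := ENNReal.lintegral_mul_le_Lp_mul_Lq ν hpq.symm
      (f := fun y => k x y ^ (1 / q) * h y) (g := fun y => k x y ^ (1 / p) * (h y)⁻¹ * g y)
      (((hkx x).pow_const _).mul hh).aemeasurable
      ((((hkx x).pow_const _).mul hh.inv).mul hg).aemeasurable
    rw [← hsplit] at hH
    have e1 : ∀ y, (k x y ^ (1 / q) * h y) ^ q = k x y * h y ^ q := fun y => by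
      rw [ENNReal.mul_rpow_of_nonneg _ _ hq.le, ← ENNReal.rpow_mul, one_div_mul_cancel hq.ne',
        ENNReal.rpow_one]
    have e2 : ∀ y, (k x y ^ (1 / p) * (h y)⁻¹ * g y) ^ p =
        k x y * (h y)⁻¹ ^ p * g y ^ p := fun y => by
      rw [ENNReal.mul_rpow_of_nonneg _ _ hp.le, ENNReal.mul_rpow_of_nonneg _ _ hp.le,
        ← ENNReal.rpow_mul, one_div_mul_cancel hp.ne', ENNReal.rpow_one]
    simp only [e1, e2] at hH
    have hmeas : Measurable (fun y => k x y * (h y)⁻¹ ^ p * g y ^ p) :=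
      ((hkx x).mul (hh.inv.pow_const _)).mul (hg.pow_const _)
    calc (∫⁻ y, k x y * g y ∂ν) ^ p
        ≤ ((A * h x ^ q) ^ (1 / q) *
          (∫⁻ y, k x y * (h y)⁻¹ ^ p * g y ^ p ∂ν) ^ (1 / p)) ^ p := by
          refine ENNReal.rpow_le_rpow (hH.trans ?_) hp.le
          gcongr
      _ = A ^ (p / q) * (h x ^ p * ∫⁻ y, k x y * (h y)⁻¹ ^ p * g y ^ p ∂ν) := by
          rw [ENNReal.mul_rpow_of_nonneg _ _ hp.le, ENNReal.mul_rpow_of_nonneg _ _ (by positivity),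
            ENNReal.mul_rpow_of_nonneg _ _ hp.le, ← ENNReal.rpow_mul, ← ENNReal.rpow_mul,
            ← ENNReal.rpow_mul, ← ENNReal.rpow_mul, one_div_mul_cancel hp.ne',
            ENNReal.rpow_one, mul_assoc, one_div_mul_eq_div, mul_div_cancel₀ p hq.ne']
      _ = _ := by rw [lintegral_const_mul _ hmeas]
  have hjoint : Measurable (fun z : X × X =>
      h z.1 ^ p * (k z.1 z.2 * (h z.2)⁻¹ ^ p * g z.2 ^ p)) :=
    ((hh.comp measurable_fst).pow_const _).mul ((hk.mul
      ((hh.comp measurable_snd).inv.pow_const _)).mul ((hg.comp measurable_snd).pow_const _))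
  calc ∫⁻ x, (∫⁻ y, k x y * g y ∂ν) ^ p ∂ν
      ≤ ∫⁻ x, A ^ (p / q) * ∫⁻ y, h x ^ p * (k x y * (h y)⁻¹ ^ p * g y ^ p) ∂ν ∂ν :=
        lintegral_mono_ae hholder
    _ = A ^ (p / q) * ∫⁻ y, ∫⁻ x, h x ^ p * (k x y * (h y)⁻¹ ^ p * g y ^ p) ∂ν ∂ν := by
        rw [lintegral_const_mul _ hjoint.lintegral_prod_right', lintegral_lintegral_swap]
        exact hjoint.aemeasurable
    _ ≤ A ^ (p / q) * ∫⁻ y, B * g y ^ p ∂ν := by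
        gcongr 1
        refine lintegral_mono_ae ?_
        filter_upwards [hB, hh0] with y hy hy0
        calc ∫⁻ x, h x ^ p * (k x y * (h y)⁻¹ ^ p * g y ^ p) ∂ν
            = (∫⁻ x, k x y * h x ^ p ∂ν) * ((h y)⁻¹ ^ p * g y ^ p) := by
              have hm : Measurable (fun x => k x y * h x ^ p) := (hky y).mul (hh.pow_const _)
              rw [← lintegral_mul_const _ hm]
              exact lintegral_congr fun x => by ring
          _ ≤ B * h y ^ p * ((h y)⁻¹ ^ p * g y ^ p) := by gcongr
          _ = B * g y ^ p * (h y * (h y)⁻¹) ^ p := by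
              rw [ENNReal.mul_rpow_of_nonneg _ _ hp.le]
              ring
          _ = B * g y ^ p := by
              rw [ENNReal.mul_inv_cancel hy0.1 hy0.2, ENNReal.one_rpow, mul_one]
    _ = A ^ (p / q) * B * ∫⁻ y, g y ^ p ∂ν := by
        rw [lintegral_const_mul _ (hg.pow_const _), mul_assoc]

end Schur

section PositiveBergmanOperator

variable {m : ℕ}

lemma lintegral_norm_add_I_rpow_lt_top {s : ℝ} (hs : (m : ℝ) + 2 < s) :
    ∫⁻ w in Siegel m, ENNReal.ofReal (‖w.2 + Complex.I‖ ^ (-s)) < ⊤ := by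
  have hm : (0 : ℝ) ≤ m := Nat.cast_nonneg m
  obtain ⟨C, -, h⟩ := lintegral_norm_srho2_rpow_le (m := m) (s := s) (a := 0) (by linarith)
    one_pos (by linarith)
  have h' := (h _ siegelBase_mem).trans_lt ENNReal.ofReal_lt_top
  simp only [neg_zero, Real.rpow_zero, mul_one] at h'
  have heq : ∀ w : SPoint m, ENNReal.ofReal (‖w.2 + Complex.I‖ ^ (-s)) =
      ENNReal.ofReal (2 ^ (-s)) * ENNReal.ofReal (‖srho2 (siegelBase m) w‖ ^ (-s)) := by
    intro w
    rw [norm_add_I_eq, Real.mul_rpow (by positivity) (by positivity),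
      ENNReal.ofReal_mul (by positivity)]
  simp_rw [heq]
  rw [lintegral_const_mul' _ _ ENNReal.ofReal_ne_top]
  exact ENNReal.mul_lt_top ENNReal.ofReal_lt_top h'

/-- The positive Bergman operator sends `|wₙ + i|^{-α}` into `Lᵖ`. -/
lemma lintegral_positive_bergman_rpow_lt_top {p α : ℝ} (hp : 1 < p)
    (hα : (m : ℝ) + 2 < α * p) :
    ∫⁻ z in Siegel m, (∫⁻ w in Siegel m, ENNReal.ofReal (‖srho2 z w‖ ^ (-((m : ℝ) + 2))) *
      ENNReal.ofReal (‖w.2 + Complex.I‖ ^ (-α))) ^ p < ⊤ := by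
  have hm : (0 : ℝ) ≤ m := Nat.cast_nonneg m
  set q := p.conjExponent
  have hpq : p.HolderConjugate q := Real.HolderConjugate.conjExponent hp
  have hp0 := hpq.pos
  have hq0 := hpq.symm.pos
  have hS := (isOpen_Siegel m).measurableSet
  obtain ⟨A, hA, hA'⟩ := lintegral_norm_srho2_rpow_le (m := m) (s := (m : ℝ) + 2) (a := 1 / p)
    (by linarith) ((div_lt_one hp0).2 hp) (by linarith [one_div_pos.2 hp0])
  obtain ⟨B, hB, hB'⟩ := lintegral_norm_srho2_rpow_le (m := m) (s := (m : ℝ) + 2) (a := 1 / q)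
    (by linarith) ((div_lt_one hq0).2 hpq.symm.lt) (by linarith [one_div_pos.2 hq0])
  set h : SPoint m → ℝ≥0∞ := fun w => ENNReal.ofReal (srho w ^ (-(1 / (p * q)))) with hh
  have hpow : ∀ w ∈ Siegel m, ∀ r r' : ℝ, 0 < r → 0 < r' →
      (ENNReal.ofReal (srho w ^ (-(1 / (r * r'))))) ^ r =
        ENNReal.ofReal (srho w ^ (-(1 / r'))) := by
    intro w hw r r' hr hr'
    have hw0 : 0 < srho w := hw
    rw [ENNReal.ofReal_rpow_of_nonneg (by positivity) hr.le, ← Real.rpow_mul hw0.le]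
    congr 2
    field_simp
  have hhq : ∀ w ∈ Siegel m, h w ^ q = ENNReal.ofReal (srho w ^ (-(1 / p))) := by
    intro w hw
    rw [hh, mul_comm p q]
    exact hpow w hw q p hq0 hp0
  have hhp : ∀ w ∈ Siegel m, h w ^ p = ENNReal.ofReal (srho w ^ (-(1 / q))) :=
    fun w hw => hpow w hw p q hp0 hq0
  have hschur := lintegral_kernel_rpow_le (ν := volume.restrict (Siegel m))
    (k := fun z w => ENNReal.ofReal (‖srho2 z w‖ ^ (-((m : ℝ) + 2)))) (h := h)
    (g := fun w => ENNReal.ofReal (‖w.2 + Complex.I‖ ^ (-α)))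
    (measurable_norm_srho2_rpow _).ennreal_ofReal
    (continuous_srho.measurable.pow_const _).ennreal_ofReal
    (((measurable_snd.add_const _).norm.pow_const _).ennreal_ofReal)
    (ae_restrict_of_forall_mem hS fun w hw => by
      have hw0 : 0 < srho w := hw
      exact ⟨(ENNReal.ofReal_pos.2 (by positivity)).ne', ENNReal.ofReal_ne_top⟩)
    hpq (A := ENNReal.ofReal A) (B := ENNReal.ofReal B)
    (ae_restrict_of_forall_mem hS fun z hz => by
      rw [hhq z hz, ← ENNReal.ofReal_mul hA]
      refine le_trans (le_of_eq ?_) ((hA' z hz).trans (le_of_eq ?_))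
      · refine setLIntegral_congr_fun hS fun w hw => ?_
        simp only [hhq w hw]
        rw [← ENNReal.ofReal_mul (by positivity)]
      · congr 3
        ring)
    (ae_restrict_of_forall_mem hS fun z hz => by
      rw [hhp z hz, ← ENNReal.ofReal_mul hB]
      refine le_trans (le_of_eq ?_) ((hB' z hz).trans (le_of_eq ?_))
      · refine setLIntegral_congr_fun hS fun w hw => ?_
        simp only [hhp w hw]
        rw [← ENNReal.ofReal_mul (by positivity), norm_srho2_comm]
      · congr 3
        ring)
  refine hschur.trans_lt (ENNReal.mul_lt_top (ENNReal.mul_lt_top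
    (ENNReal.rpow_lt_top_of_nonneg (by positivity) ENNReal.ofReal_ne_top)
    ENNReal.ofReal_lt_top) ?_)
  refine lt_of_eq_of_lt ?_ (lintegral_norm_add_I_rpow_lt_top hα)
  refine lintegral_congr fun w => ?_
  rw [ENNReal.ofReal_rpow_of_nonneg (by positivity) hp0.le, ← Real.rpow_mul (by positivity),
    neg_mul]

lemma lintegral_positive_bergman_lt_top {p α : ℝ} (hp : 1 < p)
    (hα : (m : ℝ) + 2 < α * p) {z : SPoint m} (hz : z ∈ Siegel m) :
    ∫⁻ w in Siegel m, ENNReal.ofReal (‖srho2 z w‖ ^ (-((m : ℝ) + 2))) *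
      ENNReal.ofReal (‖w.2 + Complex.I‖ ^ (-α)) < ⊤ := by
  have hm : (0 : ℝ) ≤ m := Nat.cast_nonneg m
  have hpq : p.HolderConjugate p.conjExponent := Real.HolderConjugate.conjExponent hp
  set q := p.conjExponent
  have hq1 := hpq.symm.lt
  have hs : (m : ℝ) + 2 < ((m : ℝ) + 2) * q := by nlinarith
  obtain ⟨C, -, h⟩ := lintegral_norm_srho2_rpow_le (m := m) (s := ((m : ℝ) + 2) * q) (a := 0)
    (by linarith) one_pos (by linarith)
  have h' := (h z hz).trans_lt ENNReal.ofReal_lt_top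
  simp only [neg_zero, Real.rpow_zero, mul_one] at h'
  have hle := ENNReal.lintegral_mul_le_Lp_mul_Lq (volume.restrict (Siegel m)) hpq.symm
    (f := fun w => ENNReal.ofReal (‖srho2 z w‖ ^ (-((m : ℝ) + 2))))
    (g := fun w => ENNReal.ofReal (‖w.2 + Complex.I‖ ^ (-α)))
    ((continuous_srho2_right z).measurable.norm.pow_const _).ennreal_ofReal.aemeasurable
    ((measurable_snd.add_const _).norm.pow_const _).ennreal_ofReal.aemeasurable
  have hpow : ∀ x r t : ℝ, 0 ≤ x → 0 < t →
      ENNReal.ofReal (x ^ (-r)) ^ t = ENNReal.ofReal (x ^ (-(r * t))) := by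
    intro x r t hx ht
    rw [ENNReal.ofReal_rpow_of_nonneg (by positivity) ht.le, ← Real.rpow_mul hx, neg_mul]
  simp only [hpow _ _ q (norm_nonneg _) hpq.symm.pos,
    hpow _ _ p (norm_nonneg _) hpq.pos] at hle
  refine hle.trans_lt (ENNReal.mul_lt_top ?_ ?_)
  · exact ENNReal.rpow_lt_top_of_nonneg (one_div_nonneg.2 hpq.symm.nonneg) h'.ne
  · exact ENNReal.rpow_lt_top_of_nonneg (one_div_nonneg.2 hpq.nonneg)
      (lintegral_norm_add_I_rpow_lt_top hα).ne

end PositiveBergmanOperator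

section Toeplitz

variable {m : ℕ}

/-- The complex derivative of the affine map `ρ(·, w)`. -/
noncomputable def srho2Deriv (w : SPoint m) : SPoint m →L[ℂ] ℂ :=
  (-(Complex.I / 2)) • ContinuousLinearMap.snd ℂ (Fin m → ℂ) ℂ -
    ∑ j, (starRingEnd ℂ) (w.1 j) •
      (ContinuousLinearMap.proj j).comp (ContinuousLinearMap.fst ℂ (Fin m → ℂ) ℂ)

lemma srho2Deriv_apply (w h : SPoint m) :
    srho2Deriv w h = -(Complex.I / 2) * h.2 - ∑ j, (starRingEnd ℂ) (w.1 j) * h.1 j := by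
  simp [srho2Deriv]

lemma continuous_srho2Deriv : Continuous (srho2Deriv : SPoint m → SPoint m →L[ℂ] ℂ) := by
  unfold srho2Deriv
  exact continuous_const.sub (continuous_finsetSum _ fun j _ =>
    (Complex.continuous_conj.comp ((continuous_apply j).comp continuous_fst)).smul
      continuous_const)

lemma srho2_sub_eq (z z₀ w : SPoint m) :
    srho2 z w - srho2 z₀ w = srho2Deriv w (z - z₀) := by
  rw [srho2Deriv_apply, srho2, srho2]
  simp only [Prod.fst_sub, Prod.snd_sub, Pi.sub_apply, mul_sub, Finset.sum_sub_distrib]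
  simp only [mul_comm]
  ring

lemma hasFDerivAt_srho2 (z w : SPoint m) :
    HasFDerivAt (fun z => srho2 z w) (srho2Deriv w) z := by
  have h : (fun z => srho2 z w) = fun z => srho2 0 w + srho2Deriv w z := by
    funext z
    have := srho2_sub_eq z 0 w
    rw [sub_zero] at this
    rw [← this]
    ring
  rw [h]
  exact (srho2Deriv w).hasFDerivAt.const_add _

lemma norm_srho2Deriv_le (w : SPoint m) : ‖srho2Deriv w‖ ≤ 1 + m * ‖w.1‖ := by
  refine ContinuousLinearMap.opNorm_le_bound _ (by positivity) fun h => ?_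
  rw [srho2Deriv_apply]
  calc ‖-(Complex.I / 2) * h.2 - ∑ j, (starRingEnd ℂ) (w.1 j) * h.1 j‖
      ≤ ‖-(Complex.I / 2) * h.2‖ + ∑ j, ‖(starRingEnd ℂ) (w.1 j) * h.1 j‖ :=
        (norm_sub_le _ _).trans (add_le_add_right (norm_sum_le _ _) _)
    _ ≤ 1 * ‖h‖ + ∑ _j : Fin m, ‖w.1‖ * ‖h‖ := by
        gcongr with j
        · rw [norm_mul]
          refine mul_le_mul ?_ (norm_snd_le h) (norm_nonneg _) zero_le_one
          simp
          norm_num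
        · rw [norm_mul, RCLike.norm_conj]
          exact mul_le_mul (norm_le_pi_norm _ j) ((norm_le_pi_norm _ j).trans (norm_fst_le h))
            (norm_nonneg _) (norm_nonneg _)
    _ = _ := by
        simp
        ring

lemma exists_norm_srho2Deriv_le {z : SPoint m} (hz : z ∈ Siegel m) :
    ∃ C : ℝ, 0 < C ∧ ∀ w ∈ Siegel m, ‖srho2Deriv w‖ ≤ C * ‖srho2 z w‖ := by
  have hz0 : 0 < srho z := hz
  refine ⟨2 * (1 + m * (‖z.1‖ + 1)) / srho z + 2 * m, by positivity, fun w hw => ?_⟩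
  have hw0 : 0 < srho w := hw
  have h1 := srho_add_le_two_mul_norm_srho2 z w
  have h2 : ‖w.1‖ ≤ ‖z.1‖ + ‖w.1 - z.1‖ := by
    simpa using norm_add_le z.1 (w.1 - z.1)
  have h3 : ‖w.1 - z.1‖ ≤ 1 + ‖w.1 - z.1‖ ^ 2 := by nlinarith [sq_nonneg (‖w.1 - z.1‖ - 1)]
  have h4 : srho z ≤ 2 * ‖srho2 z w‖ := by nlinarith [sq_nonneg ‖w.1 - z.1‖]
  calc ‖srho2Deriv w‖ ≤ 1 + m * ‖w.1‖ := norm_srho2Deriv_le w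
    _ ≤ 1 + m * (‖z.1‖ + 1 + 2 * ‖srho2 z w‖) := by
        gcongr
        linarith
    _ = (1 + m * (‖z.1‖ + 1)) / srho z * srho z + 2 * m * ‖srho2 z w‖ := by
        field_simp
        ring
    _ ≤ (1 + m * (‖z.1‖ + 1)) / srho z * (2 * ‖srho2 z w‖) + 2 * m * ‖srho2 z w‖ := by
        gcongr
    _ = _ := by ring

lemma norm_zpow_neg_eq_rpow (x : ℂ) (k : ℕ) :
    ‖x ^ (-(k + 1 : ℤ))‖ = ‖x‖ ^ (-((k : ℝ) + 1)) := by
  rw [norm_zpow, ← Real.rpow_intCast]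
  push_cast
  rfl

lemma norm_sK (n : ℕ) (z w : SPoint (n - 1)) :
    ‖sK n z w‖ = n.factorial / (4 * Real.pi ^ n) * ‖srho2 z w‖ ^ (-((n : ℝ) + 1)) := by
  rw [sK, norm_mul, norm_zpow_neg_eq_rpow]
  simp [abs_of_pos Real.pi_pos]

/-- Holomorphy of integrals of `sK n z w * f w` in the parameter `z`. -/
lemma differentiableOn_integral_sK {n : ℕ} {μ : Measure (SPoint (n - 1))}
    {f : SPoint (n - 1) → ℂ} (hf : ContinuousOn f (Siegel (n - 1)))
    (hint : ∀ z ∈ Siegel (n - 1),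
      IntegrableOn (fun w => sK n z w * f w) (Siegel (n - 1)) μ) :
    DifferentiableOn ℂ (fun z => ∫ w in Siegel (n - 1), sK n z w * f w ∂μ)
      (Siegel (n - 1)) := by
  intro z₀ hz₀
  refine DifferentiableAt.differentiableWithinAt ?_
  have hopen := isOpen_Siegel (n - 1)
  have hS := hopen.measurableSet
  obtain ⟨C, hC, hCw⟩ := exists_norm_srho2Deriv_le hz₀
  set c : ℂ := (n.factorial : ℂ) / (4 * (Real.pi : ℂ) ^ n) with hc
  set F' : SPoint (n - 1) → SPoint (n - 1) → SPoint (n - 1) →L[ℂ] ℂ := fun z w =>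
    (f w * c * (((-(n + 1 : ℤ) : ℤ) : ℂ) * srho2 z w ^ (-(n + 1 : ℤ) - 1))) • srho2Deriv w
    with hF'
  have hnhds : Siegel (n - 1) ∩ Metric.ball z₀ (1 / (2 * C)) ∈ nhds z₀ :=
    inter_mem (hopen.mem_nhds hz₀) (Metric.ball_mem_nhds _ (by positivity))
  have hlow : ∀ w ∈ Siegel (n - 1), ∀ z ∈ Siegel (n - 1) ∩ Metric.ball z₀ (1 / (2 * C)),
      ‖srho2 z₀ w‖ / 2 ≤ ‖srho2 z w‖ := by
    intro w hw z hz
    have h1 : ‖srho2 z w - srho2 z₀ w‖ ≤ ‖srho2 z₀ w‖ / 2 := by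
      rw [srho2_sub_eq]
      calc ‖srho2Deriv w (z - z₀)‖ ≤ ‖srho2Deriv w‖ * ‖z - z₀‖ :=
            (srho2Deriv w).le_opNorm _
        _ ≤ (C * ‖srho2 z₀ w‖) * (1 / (2 * C)) := by
            gcongr
            · exact hCw w hw
            · exact (mem_ball_iff_norm.1 hz.2).le
        _ = _ := by field_simp
    have h2 := norm_sub_norm_le (srho2 z₀ w) (srho2 z w)
    rw [norm_sub_rev] at h2
    linarith
  refine (hasFDerivAt_integral_of_dominated_of_fderiv_le (μ := μ.restrict (Siegel (n - 1)))
    (F := fun z w => sK n z w * f w) (F' := F')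
    (bound := fun w => ((n + 1 : ℝ) * 2 ^ (n + 2) * C) * ‖sK n z₀ w * f w‖)
    hnhds ?_ (hint z₀ hz₀) ?_ ?_ ((hint z₀ hz₀).norm.const_mul _) ?_).differentiableAt
  · filter_upwards [hopen.mem_nhds hz₀] with z hz
    exact (hint z hz).aestronglyMeasurable
  · refine ContinuousOn.aestronglyMeasurable ?_ hS
    refine ContinuousOn.fun_smul ?_ continuous_srho2Deriv.continuousOn
    refine (hf.mul continuousOn_const).mul (continuousOn_const.mul ?_)
    exact (continuous_srho2_right z₀).continuousOn.zpow₀ _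
      fun w hw => Or.inl (srho2_ne_zero hz₀ hw)
  · refine ae_restrict_of_forall_mem hS fun w hw z hz => ?_
    have hpos : 0 < ‖srho2 z₀ w‖ := norm_pos_iff.2 (srho2_ne_zero hz₀ hw)
    have hz := hlow w hw z hz
    have hz' : 0 < ‖srho2 z w‖ := by linarith
    have e1 : ‖srho2 z w‖⁻¹ ≤ 2 * ‖srho2 z₀ w‖⁻¹ := by
      calc ‖srho2 z w‖⁻¹ ≤ (‖srho2 z₀ w‖ / 2)⁻¹ := inv_anti₀ (by positivity) hz
        _ = _ := by field_simp
    have e2 : ‖srho2 z w ^ (-(n + 1 : ℤ) - 1)‖ = ‖srho2 z w‖⁻¹ ^ (n + 2) := by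
      rw [norm_zpow, inv_pow, ← zpow_natCast, ← zpow_neg]
      rfl
    have e3 : ‖srho2 z₀ w ^ (-(n + 1 : ℤ))‖ = ‖srho2 z₀ w‖⁻¹ ^ (n + 1) := by
      rw [norm_zpow, inv_pow, ← zpow_natCast, ← zpow_neg]
      rfl
    have e4 : ‖((-(n + 1 : ℤ) : ℤ) : ℂ)‖ = n + 1 := by
      rw [Complex.norm_intCast]
      push_cast
      rw [abs_neg, abs_of_nonneg (by positivity)]
    rw [hF', sK, norm_smul, norm_mul, norm_mul, norm_mul, norm_mul, norm_mul, e2, e3, e4, ← hc]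
    calc ‖f w‖ * ‖c‖ * ((n + 1) * ‖srho2 z w‖⁻¹ ^ (n + 2)) * ‖srho2Deriv w‖
        ≤ ‖f w‖ * ‖c‖ * ((n + 1) * (2 * ‖srho2 z₀ w‖⁻¹) ^ (n + 2)) * (C * ‖srho2 z₀ w‖) := by
          gcongr
          exact hCw w hw
      _ = _ := by
          rw [mul_pow, pow_succ ‖srho2 z₀ w‖⁻¹ (n + 1)]
          field_simp
  · refine ae_restrict_of_forall_mem hS fun w hw z hz => ?_
    have h := (hasDerivAt_zpow (-(n + 1 : ℤ)) (srho2 z w)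
      (Or.inl (srho2_ne_zero hz.1 hw))).comp_hasFDerivAt z (hasFDerivAt_srho2 z w)
    have h' := h.const_mul (f w * c)
    rw [smul_smul] at h'
    refine h'.congr_of_eventuallyEq (Eventually.of_forall fun x => ?_)
    simp only [sK, Function.comp_apply, ← hc]
    ring

/-- Testing an `A¹` Carleson measure on `ρ(w, z)^{-(n+1)} (wₙ + i)^{-α}`. -/
lemma lintegral_carleson_le {n : ℕ} {μ : Measure (SPoint (n - 1))} {C : ℝ}
    (hμ : ∀ f : SPoint (n - 1) → ℂ, MemAp n 1 f →
      ∫⁻ z in Siegel (n - 1), ENNReal.ofReal (‖f z‖) ∂μ ≤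
        ENNReal.ofReal C * ∫⁻ z in Siegel (n - 1), ENNReal.ofReal (‖f z‖))
    {α : ℝ} {z : SPoint (n - 1)} (hz : z ∈ Siegel (n - 1))
    (hfin : ∫⁻ w in Siegel (n - 1), ENNReal.ofReal (‖srho2 z w‖ ^ (-((n : ℝ) + 1))) *
      ENNReal.ofReal (‖w.2 + Complex.I‖ ^ (-α)) < ⊤) :
    ∫⁻ w in Siegel (n - 1), ENNReal.ofReal (‖srho2 z w‖ ^ (-((n : ℝ) + 1))) *
      ENNReal.ofReal (‖w.2 + Complex.I‖ ^ (-α)) ∂μ ≤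
    ENNReal.ofReal C * ∫⁻ w in Siegel (n - 1),
      ENNReal.ofReal (‖srho2 z w‖ ^ (-((n : ℝ) + 1))) *
        ENNReal.ofReal (‖w.2 + Complex.I‖ ^ (-α)) := by
  set F : SPoint (n - 1) → ℂ := fun w =>
    srho2 w z ^ (-(n + 1 : ℤ)) * (-Complex.I * (w.2 + Complex.I)) ^ ((-α : ℝ) : ℂ) with hF
  have hnorm : ∀ w, ENNReal.ofReal ‖F w‖ = ENNReal.ofReal (‖srho2 z w‖ ^ (-((n : ℝ) + 1))) *
      ENNReal.ofReal (‖w.2 + Complex.I‖ ^ (-α)) := by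
    intro w
    rw [← ENNReal.ofReal_mul (by positivity), hF, norm_mul, norm_zpow_neg_eq_rpow,
      norm_srho2_comm w z, Complex.norm_cpow_real, norm_mul, norm_neg, Complex.norm_I, one_mul]
  have hdiff : DifferentiableOn ℂ F (Siegel (n - 1)) := by
    intro w hw
    refine DifferentiableAt.differentiableWithinAt (DifferentiableAt.mul ?_ ?_)
    · exact (hasFDerivAt_srho2 w z).differentiableAt.zpow (Or.inl (srho2_ne_zero hw hz))
    · refine DifferentiableAt.cpow (by fun_prop) (by fun_prop) (Or.inl ?_)
      have hw0 : 0 < srho w := hw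
      have : 0 ≤ ∑ j, ‖w.1 j‖ ^ 2 := Finset.sum_nonneg fun j _ => sq_nonneg _
      rw [srho] at hw0
      simp
      linarith
  have hmem : MemAp n 1 F := by
    refine ⟨hdiff, ?_⟩
    simp only [Real.rpow_one]
    refine Integrable.norm ⟨hdiff.continuousOn.aestronglyMeasurable
      (isOpen_Siegel _).measurableSet, ?_⟩
    rw [hasFiniteIntegral_iff_norm]
    simpa only [hnorm] using hfin
  simpa only [hnorm] using hμ F hmem

end Toeplitz

/-- if `μ ∈ ℳ₊` is a Carleson measure for `A¹(𝒰)` and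
`n + 1/p < α < n + 1`, then `T_μ` maps `𝒮_α` into `Aᵖ(𝒰)`. -/
theorem toeplitz_maps_Salpha_into_Ap (n : ℕ) (hn : 1 ≤ n) (p : ℝ) (hp : 1 < p)
    (α : ℝ) (hα1 : (n : ℝ) + 1 / p < α) (hα2 : α < (n : ℝ) + 1)
    (μ : Measure (SPoint (n - 1)))
    (hμM : ∃ α₀ : ℝ, 0 < α₀ ∧
      ∫⁻ w in Siegel (n - 1),
        ENNReal.ofReal (‖w.2 + Complex.I‖ ^ (-α₀)) ∂μ < ⊤)
    (hμC : ∃ C : ℝ, 0 < C ∧ ∀ f : SPoint (n - 1) → ℂ, MemAp n 1 f →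
      ∫⁻ z in Siegel (n - 1), ENNReal.ofReal (‖f z‖) ∂μ ≤
        ENNReal.ofReal C * ∫⁻ z in Siegel (n - 1), ENNReal.ofReal (‖f z‖))
    (f : SPoint (n - 1) → ℂ) (hf : SAlpha n α f) :
    MemAp n p (fun z => ∫ w in Siegel (n - 1), sK n z w * f w ∂μ) := by
  obtain ⟨C, hC, hcarl⟩ := hμC
  obtain ⟨hfd, M, hM⟩ := hf
  have hS := (isOpen_Siegel (n - 1)).measurableSet
  have hn1 : (1 : ℝ) ≤ n := by exact_mod_cast hn
  have hcast : ((n - 1 : ℕ) : ℝ) + 2 = n + 1 := by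
    rw [Nat.cast_sub hn]
    push_cast
    ring
  have hp0 : 0 < p := by linarith
  have hαp : ((n - 1 : ℕ) : ℝ) + 2 < α * p := by
    have h1 : ((n : ℝ) + 1 / p) * p < α * p := mul_lt_mul_of_pos_right hα1 hp0
    rw [add_mul, one_div_mul_cancel hp0.ne'] at h1
    rw [hcast]
    nlinarith
  set G : SPoint (n - 1) → ℝ≥0∞ := fun z => ∫⁻ w in Siegel (n - 1),
    ENNReal.ofReal (‖srho2 z w‖ ^ (-((n : ℝ) + 1))) *
      ENNReal.ofReal (‖w.2 + Complex.I‖ ^ (-α))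
  have hGfin : ∀ z ∈ Siegel (n - 1), G z < ⊤ := by
    intro z hz
    have h := lintegral_positive_bergman_lt_top hp hαp hz
    rwa [hcast] at h
  have hGp : ∫⁻ z in Siegel (n - 1), G z ^ p < ⊤ := by
    have h := lintegral_positive_bergman_rpow_lt_top hp hαp
    rwa [hcast] at h
  set c : ℝ := n.factorial / (4 * Real.pi ^ n) with hc
  have hc0 : 0 ≤ c := by positivity
  have hM0 : 0 ≤ M := le_trans (by positivity) (hM _ siegelBase_mem)
  have hfbd : ∀ w ∈ Siegel (n - 1), ‖f w‖ ≤ M * ‖w.2 + Complex.I‖ ^ (-α) := by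
    intro w hw
    have hpos := norm_add_I_pos hw
    rw [Real.rpow_neg hpos.le, ← div_eq_mul_inv, le_div_iff₀ (Real.rpow_pos_of_pos hpos _),
      mul_comm]
    exact hM w hw
  have hbound : ∀ z ∈ Siegel (n - 1),
      ∫⁻ w in Siegel (n - 1), ‖sK n z w * f w‖ₑ ∂μ ≤ ENNReal.ofReal (c * M * C) * G z := by
    intro z hz
    calc ∫⁻ w in Siegel (n - 1), ‖sK n z w * f w‖ₑ ∂μ
        ≤ ∫⁻ w in Siegel (n - 1), ENNReal.ofReal (c * M) *
          (ENNReal.ofReal (‖srho2 z w‖ ^ (-((n : ℝ) + 1))) *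
            ENNReal.ofReal (‖w.2 + Complex.I‖ ^ (-α))) ∂μ := by
          refine setLIntegral_mono' hS fun w hw => ?_
          rw [← ofReal_norm, ← ENNReal.ofReal_mul (by positivity),
            ← ENNReal.ofReal_mul (by positivity), norm_mul, norm_sK, ← hc]
          refine ENNReal.ofReal_le_ofReal ?_
          calc c * ‖srho2 z w‖ ^ (-((n : ℝ) + 1)) * ‖f w‖
              ≤ c * ‖srho2 z w‖ ^ (-((n : ℝ) + 1)) * (M * ‖w.2 + Complex.I‖ ^ (-α)) := by
                gcongr
                exact hfbd w hw
            _ = _ := by ring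
      _ ≤ ENNReal.ofReal (c * M) * (ENNReal.ofReal C * G z) := by
          rw [lintegral_const_mul' _ _ ENNReal.ofReal_ne_top]
          gcongr
          exact lintegral_carleson_le hcarl hz (hGfin z hz)
      _ = ENNReal.ofReal (c * M * C) * G z := by
          rw [← mul_assoc, ← ENNReal.ofReal_mul (by positivity)]
  have hint : ∀ z ∈ Siegel (n - 1),
      IntegrableOn (fun w => sK n z w * f w) (Siegel (n - 1)) μ := by
    intro z hz
    refine ⟨ContinuousOn.aestronglyMeasurable ?_ hS, (hbound z hz).trans_lt
      (ENNReal.mul_lt_top ENNReal.ofReal_lt_top (hGfin z hz))⟩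
    refine ContinuousOn.mul (continuousOn_const.mul ?_) hfd.continuousOn
    exact (continuous_srho2_right z).continuousOn.zpow₀ _
      fun w hw => Or.inl (srho2_ne_zero hz hw)
  have hdiff := differentiableOn_integral_sK hfd.continuousOn hint
  refine ⟨hdiff, ?_, ?_⟩
  · exact (hdiff.continuousOn.norm.rpow_const fun _ _ => Or.inr hp0.le).aestronglyMeasurable hS
  · calc ∫⁻ z in Siegel (n - 1), ‖‖∫ w in Siegel (n - 1), sK n z w * f w ∂μ‖ ^ p‖ₑ
        ≤ ∫⁻ z in Siegel (n - 1), ENNReal.ofReal (c * M * C) ^ p * G z ^ p := by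
          refine setLIntegral_mono' hS fun z hz => ?_
          rw [← ofReal_norm, Real.norm_of_nonneg (by positivity),
            ← ENNReal.ofReal_rpow_of_nonneg (norm_nonneg _) hp0.le, ofReal_norm,
            ← ENNReal.mul_rpow_of_nonneg _ _ hp0.le]
          exact ENNReal.rpow_le_rpow ((enorm_integral_le_lintegral_enorm _).trans (hbound z hz))
            hp0.le
      _ < ⊤ := by
          have hfinite : ENNReal.ofReal (c * M * C) ^ p < ⊤ :=
            ENNReal.rpow_lt_top_of_nonneg hp0.le ENNReal.ofReal_ne_top
          rw [lintegral_const_mul' _ _ hfinite.ne]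
          exact ENNReal.mul_lt_top hfinite hGp
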